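/- arXiv:1909.03097 — 8 statements merged into one kernel-verified Lean document; each statement's English description precedes it below -/
import Mathlib

section
/- Let A be a finite group of order |A| and let n ≥ 1. Let W = A ∗ ⋯ ∗ A be the free product of n copies of A, with canonical injections ι_i : A → W (1 ≤ i ≤ n), and let π : W → A be the homomorphism restricting to the identity on each factor (π ∘ ι_i = id for all i). Then the kernel F = ker π is a free group of rank (n−1)(|A|−1); that is, F is isomorphic as a group to the free group on (n−1)(|A|−1) generators. -/
namespace KerFree

open Monoid

variable {I A : Type*} [Group A] (o : I)

/-- Index set of the basis. -/
abbrev S (A : Type*) [Group A] (o : I) : Type _ := {i : I // i ≠ o} × {a : A // a ≠ 1}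

open Classical in
/-- Generator `e i a`, trivial if `i = o` or `a = 1`. -/
noncomputable def e (i : I) (a : A) : FreeGroup (S A o) :=
  if h : i ≠ o ∧ a ≠ 1 then FreeGroup.of (⟨i, h.1⟩, ⟨a, h.2⟩) else 1

lemma e_base (a : A) : e o o a = 1 := by simp [e]

lemma e_one (i : I) : e o i (1 : A) = 1 := by simp [e]

lemma e_of (s : S A o) : e o s.1.1 s.2.1 = FreeGroup.of s := by
  have h : s.1.1 ≠ o ∧ s.2.1 ≠ 1 := ⟨s.1.2, s.2.2⟩
  rw [e, dif_pos h]

/-- The action as an endomorphism. -/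
noncomputable def act (b : A) : FreeGroup (S A o) →* FreeGroup (S A o) :=
  FreeGroup.lift fun s => (e o s.1.1 b)⁻¹ * e o s.1.1 (b * s.2.1)

lemma act_e (b : A) (i : I) (a : A) : act o b (e o i a) = (e o i b)⁻¹ * e o i (b * a) := by
  by_cases hi : i = o
  · subst hi; simp [e_base]
  by_cases ha : a = 1
  · subst ha; simp [e_one]
  have := e_of o ((⟨i, hi⟩, ⟨a, ha⟩) : S A o)
  simp only at this
  rw [this, act, FreeGroup.lift_apply_of]

lemma act_one : act o (1 : A) = MonoidHom.id _ := by
  ext s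
  rw [← e_of, act_e]
  simp [e_one]

lemma act_mul (b c : A) : act o (b * c) = (act o b).comp (act o c) := by
  ext s
  rw [← e_of, MonoidHom.comp_apply, act_e, act_e, map_mul, map_inv, act_e, act_e]
  simp [mul_assoc]

/-- The action by automorphisms. -/
noncomputable def phi : A →* MulAut (FreeGroup (S A o)) where
  toFun b := MonoidHom.toMulEquiv (act o b) (act o b⁻¹)
    (by rw [← act_mul, inv_mul_cancel, act_one]) (by rw [← act_mul, mul_inv_cancel, act_one])
  map_one' := by
    ext x
    exact DFunLike.congr_fun (act_one o) x
  map_mul' b c := by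
    ext x
    exact DFunLike.congr_fun (act_mul o b c) x

lemma phi_apply (b : A) (x : FreeGroup (S A o)) : phi o b x = act o b x := rfl

/-- The map from the free product to the semidirect product. -/
noncomputable def psi : CoprodI (fun _ : I => A) →* FreeGroup (S A o) ⋊[phi o] A :=
  CoprodI.lift fun i =>
    { toFun := fun a => ⟨e o i a, a⟩
      map_one' := by ext <;> simp [e_one]
      map_mul' := fun a b => by
        ext
        · simp [phi_apply, act_e]
        · simp }

lemma psi_of (i : I) (a : A) :
    psi o (CoprodI.of (M := fun _ : I => A) (i := i) a) = ⟨e o i a, a⟩ := by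
  rw [psi, CoprodI.lift_of]; rfl

/-- The injection of the `i`th factor. -/
def inj (i : I) : A →* CoprodI (fun _ : I => A) := CoprodI.of (M := fun _ : I => A) (i := i)

lemma psi_inj (i : I) (a : A) : psi o (inj i a) = ⟨e o i a, a⟩ := psi_of o i a

/-- The map from the free group. -/
noncomputable def theta : FreeGroup (S A o) →* CoprodI (fun _ : I => A) :=
  FreeGroup.lift fun s => inj s.1.1 s.2.1 * (inj o s.2.1)⁻¹

lemma theta_e (i : I) (a : A) : theta o (e o i a) = inj i a * (inj o a)⁻¹ := by
  by_cases hi : i = o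
  · subst hi; simp [e_base]
  by_cases ha : a = 1
  · subst ha; simp [e_one]
  have := e_of o ((⟨i, hi⟩, ⟨a, ha⟩) : S A o)
  simp only at this
  rw [this, theta, FreeGroup.lift_apply_of]

lemma theta_act (b : A) (x : FreeGroup (S A o)) :
    theta o (act o b x) = inj o b * theta o x * (inj o b)⁻¹ := by
  have : (theta o).comp (act o b) = (MulAut.conj (inj o b)).toMonoidHom.comp (theta o) := by
    ext s
    simp only [MonoidHom.comp_apply]
    rw [← e_of, act_e, map_mul, map_inv, theta_e, theta_e, theta_e]
    simp [MulAut.conj_apply, mul_assoc]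
  exact DFunLike.congr_fun this x

/-- The inverse of `psi`. -/
noncomputable def big : FreeGroup (S A o) ⋊[phi o] A →* CoprodI (fun _ : I => A) :=
  SemidirectProduct.lift (theta o) (inj o) (by
    intro b
    ext1 s
    exact theta_act o b _)

lemma big_psi (w : CoprodI (fun _ : I => A)) : big o (psi o w) = w := by
  have : (big o).comp (psi o) = MonoidHom.id (CoprodI (fun _ : I => A)) := by
    apply CoprodI.ext_hom
    intro i
    ext a
    change big o (psi o (CoprodI.of (M := fun _ : I => A) (i := i) a)) = inj i a
    rw [psi_of, SemidirectProduct.mk_eq_inl_mul_inr, map_mul, big,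
      SemidirectProduct.lift_inl, SemidirectProduct.lift_inr, theta_e]
    simp
  exact DFunLike.congr_fun this w

lemma psi_theta (x : FreeGroup (S A o)) : psi o (theta o x) = SemidirectProduct.inl x := by
  have : (psi (A := A) o).comp (theta o) = SemidirectProduct.inl := by
    ext1 s
    rw [MonoidHom.comp_apply, ← e_of, theta_e, map_mul, map_inv]
    rw [psi_inj, psi_inj, mul_inv_eq_iff_eq_mul]
    ext <;> simp [e_base]
  exact DFunLike.congr_fun this x

theorem main (π : CoprodI (fun _ : I => A) →* A)
    (hπ : ∀ (i : I) (a : A), π (CoprodI.of (M := fun _ : I => A) (i := i) a) = a) :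
    Nonempty (π.ker ≃* FreeGroup (S A o)) := by
  have hr : ∀ w, (psi o w).right = π w := by
    intro w
    have : (SemidirectProduct.rightHom).comp (psi o) = π := by
      apply CoprodI.ext_hom
      intro i
      ext a
      change SemidirectProduct.rightHom (psi o (CoprodI.of (M := fun _ : I => A) (i := i) a)) =
        π (CoprodI.of (M := fun _ : I => A) (i := i) a)
      rw [psi_of, hπ]; rfl
    exact DFunLike.congr_fun this w
  have hk : ∀ x, theta o x ∈ π.ker := by
    intro x
    rw [MonoidHom.mem_ker, ← hr, psi_theta]; rfl
  refine ⟨(MulEquiv.ofBijective ((theta o).codRestrict π.ker hk) ⟨?_, ?_⟩).symm⟩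
  · intro x y h
    have h' : theta o x = theta o y := congrArg Subtype.val h
    have := congrArg (psi o) h'
    rw [psi_theta, psi_theta] at this
    exact SemidirectProduct.inl_injective this
  · rintro ⟨w, hw⟩
    refine ⟨(psi o w).left, Subtype.ext ?_⟩
    change theta o (psi o w).left = w
    have h1 : psi o w = SemidirectProduct.inl (psi o w).left := by
      ext
      · simp
      · rw [hr, MonoidHom.mem_ker.1 hw]; rfl
    conv_rhs => rw [← big_psi o w, h1, big, SemidirectProduct.lift_inl]

end KerFree

/-- Let `A` be a finite group and `n ≥ 1`. Let `W` be the free product of `n`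
copies of `A` with canonical injections `ι_i`, and `π : W → A` the homomorphism restricting to
the identity on each factor. Then `ker π` is a free group of rank `(n-1)(|A|-1)`. -/
theorem stmt_0 (n : ℕ) (hn : 1 ≤ n) (A : Type*) [Group A] [Finite A]
    (π : Monoid.CoprodI (fun _ : Fin n => A) →* A)
    (hπ : ∀ (i : Fin n) (a : A),
      π (Monoid.CoprodI.of (M := fun _ : Fin n => A) (i := i) a) = a) :
    Nonempty (π.ker ≃* FreeGroup (Fin ((n - 1) * (Nat.card A - 1)))) := by
  obtain ⟨f⟩ := KerFree.main (⟨0, hn⟩ : Fin n) π hπ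
  classical
  have := Fintype.ofFinite A
  have hc : Nat.card (KerFree.S A (⟨0, hn⟩ : Fin n)) = (n - 1) * (Nat.card A - 1) := by
    simp [KerFree.S, Nat.card_eq_fintype_card, Fintype.card_subtype_compl]
  exact ⟨f.trans (FreeGroup.freeGroupCongr (Finite.equivFinOfCardEq hc))⟩
end

section
/- Let A be a finite group and let n ≥ 1. Let W = A ∗ ⋯ ∗ A be the free product of n copies of A, with canonical injections ι_i : A → W (1 ≤ i ≤ n), and let π : W → A be the homomorphism restricting to the identity on each factor. Then the family of elements ι_1(a)⁻¹ · ι_i(a), indexed by pairs (a, i) with a ∈ A ∖ {1} and 2 ≤ i ≤ n, is a free basis of the kernel F = ker π; that is, F is freely generated by these (n−1)(|A|−1) elements. -/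
namespace Stmt1

open scoped Classical in
/-- The generator `x(a,i)`, extended by `1` when `a = 1` or `i = o`. -/
noncomputable def gen {A I : Type*} [Group A] (o : I) (a : A) (i : I) :
    FreeGroup ({a : A // a ≠ 1} × {i : I // i ≠ o}) :=
  if h : a ≠ 1 ∧ i ≠ o then FreeGroup.of (⟨a, h.1⟩, ⟨i, h.2⟩) else 1

theorem gen_one {A I : Type*} [Group A] (o : I) (i : I) : gen o (1 : A) i = 1 := by
  simp [gen]

theorem gen_base {A I : Type*} [Group A] (o : I) (a : A) : gen o a o = 1 := by
  simp [gen]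

theorem gen_of {A I : Type*} [Group A] (o : I)
    (p : {a : A // a ≠ 1} × {i : I // i ≠ o}) : gen o p.1.1 p.2.1 = FreeGroup.of p := by
  simp [gen, p.1.2, p.2.2]

/-- The endomorphism by which `b` acts. -/
noncomputable def act {A I : Type*} [Group A] (o : I) (b : A) :
    FreeGroup ({a : A // a ≠ 1} × {i : I // i ≠ o}) →*
    FreeGroup ({a : A // a ≠ 1} × {i : I // i ≠ o}) :=
  FreeGroup.lift fun p => gen o (p.1.1 * b⁻¹) p.2.1 * (gen o b⁻¹ p.2.1)⁻¹

theorem act_gen {A I : Type*} [Group A] (o : I) (b a : A) (i : I) :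
    act o b (gen o a i) = gen o (a * b⁻¹) i * (gen o b⁻¹ i)⁻¹ := by
  by_cases ha : a = 1
  · subst ha; simp [gen_one]
  by_cases hi : i = o
  · subst hi; simp [gen_base]
  have := gen_of o (⟨⟨a, ha⟩, ⟨i, hi⟩⟩ : {a : A // a ≠ 1} × {i : I // i ≠ o})
  simp only at this
  rw [this]
  simp [act]

theorem act_one {A I : Type*} [Group A] (o : I) : act o (1 : A) = MonoidHom.id _ := by
  ext p
  simp [act, gen_one, gen_of]

theorem act_mul {A I : Type*} [Group A] (o : I) (c b : A) :
    act o (c * b) = (act o c).comp (act o b) := by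
  ext p
  rw [← gen_of, MonoidHom.comp_apply, act_gen, act_gen, map_mul, map_inv, act_gen, act_gen]
  simp [mul_assoc]

/-- The action by automorphisms. -/
noncomputable def phi {A I : Type*} [Group A] (o : I) :
    A →* MulAut (FreeGroup ({a : A // a ≠ 1} × {i : I // i ≠ o})) where
  toFun b := MonoidHom.toMulEquiv (act o b) (act o b⁻¹)
    (by rw [← act_mul, inv_mul_cancel, act_one]) (by rw [← act_mul, mul_inv_cancel, act_one])
  map_one' := by
    ext1 x
    exact DFunLike.congr_fun (act_one o) x
  map_mul' b c := by
    ext1 x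
    exact DFunLike.congr_fun (act_mul o b c) x

theorem phi_apply {A I : Type*} [Group A] (o : I) (b : A)
    (x : FreeGroup ({a : A // a ≠ 1} × {i : I // i ≠ o})) : phi o b x = act o b x := rfl

/-- The map on the `i`-th factor into the semidirect product. -/
noncomputable def factor {A I : Type*} [Group A] (o i : I) :
    A →* SemidirectProduct (FreeGroup ({a : A // a ≠ 1} × {i : I // i ≠ o})) A (phi o) where
  toFun a := SemidirectProduct.inr a * SemidirectProduct.inl (gen o a i)
  map_one' := by simp [gen_one]
  map_mul' a b := by
    ext
    · simp [phi_apply, act_gen, mul_assoc]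
    · simp

theorem factor_apply {A I : Type*} [Group A] (o i : I) (a : A) :
    factor o i a = SemidirectProduct.inr a * SemidirectProduct.inl (gen o a i) := rfl

theorem main {A I : Type*} [Group A] (o : I) (π : Monoid.CoprodI (fun _ : I => A) →* A)
    (hπ : ∀ (i : I) (a : A),
      π (Monoid.CoprodI.of (M := fun _ : I => A) (i := i) a) = a)
    (f : {a : A // a ≠ 1} × {i : I // i ≠ o} → π.ker)
    (hf : ∀ p, (f p : Monoid.CoprodI (fun _ : I => A)) =
      (Monoid.CoprodI.of (M := fun _ : I => A) (i := o) p.1.val)⁻¹ *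
            Monoid.CoprodI.of (M := fun _ : I => A) (i := p.2.val) p.1.val) :
    Function.Bijective (FreeGroup.lift f) := by
  let W := Monoid.CoprodI (fun _ : I => A)
  let Φ : W →* _ := Monoid.CoprodI.lift (fun i => factor (A := A) o i)
  have hΦ : ∀ i a, Φ (Monoid.CoprodI.of (M := fun _ : I => A) (i := i) a) = factor o i a := by
    intro i a; exact Monoid.CoprodI.lift_of _ _
  let L : FreeGroup ({a : A // a ≠ 1} × {i : I // i ≠ o}) →* W :=
    π.ker.subtype.comp (FreeGroup.lift f)
  have hL : ∀ a i, L (gen o a i) = (Monoid.CoprodI.of (M := fun _ : I => A) (i := o) a)⁻¹ *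
      Monoid.CoprodI.of (M := fun _ : I => A) (i := i) a := by
    intro a i
    by_cases ha : a = 1
    · subst ha; simp [gen_one]
    by_cases hi : i = o
    · subst hi; simp [gen_base]
    have := gen_of o (⟨⟨a, ha⟩, ⟨i, hi⟩⟩ : {a : A // a ≠ 1} × {i : I // i ≠ o})
    simp only at this
    rw [this]
    simp [L, hf]
  have h1 : Φ.comp L = SemidirectProduct.inl := by
    ext1 p
    rw [← gen_of, MonoidHom.comp_apply, hL, map_mul, map_inv, hΦ, hΦ, factor_apply, factor_apply,
      gen_base]
    simp
  let Ψ := SemidirectProduct.lift (φ := phi o) L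
    (Monoid.CoprodI.of (M := fun _ : I => A) (i := o)) (by
      intro b
      ext1 p
      rw [← gen_of]
      simp only [MonoidHom.comp_apply, MulEquiv.coe_toMonoidHom, phi_apply, act_gen, map_mul,
        map_inv, hL, MulAut.conj_apply]
      group)
  have h2 : Ψ.comp Φ = MonoidHom.id W := by
    apply Monoid.CoprodI.ext_hom
    intro i
    ext1 a
    simp only [MonoidHom.comp_apply, hΦ, factor_apply, map_mul, Ψ, SemidirectProduct.lift_inl,
      SemidirectProduct.lift_inr, hL]
    exact mul_inv_cancel_left _ _
  have h3 : SemidirectProduct.rightHom.comp Φ = π := by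
    apply Monoid.CoprodI.ext_hom
    intro i
    ext1 a
    simp only [MonoidHom.comp_apply, hΦ, factor_apply, hπ]
    simp
  constructor
  · intro x y h
    have : L x = L y := congrArg Subtype.val h
    apply SemidirectProduct.inl_injective (φ := phi o)
    rw [← h1]
    exact congrArg Φ this
  · rintro ⟨w, hw⟩
    have hr : SemidirectProduct.rightHom (Φ w) = 1 := by
      rw [← MonoidHom.comp_apply, h3]; exact hw
    refine ⟨(Φ w).left, Subtype.ext ?_⟩
    change L (Φ w).left = w
    have h4 : Ψ (Φ w) = w := DFunLike.congr_fun h2 w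
    have h5 : SemidirectProduct.inl (Φ w).left = Φ w := by
      ext
      · simp
      · simpa using hr.symm
    rw [← h5] at h4
    simpa only [Ψ, SemidirectProduct.lift_inl] using h4

end Stmt1

/-- Let `A` be a finite group, `n ≥ 1`, `W` the free product of `n` copies of `A`
with canonical injections `ι_i`, and `π : W → A` the homomorphism restricting to the identity on
each factor. The family of elements `ι_1(a)⁻¹ * ι_i(a)`, indexed by pairs `(a, i)` with
`a ∈ A \ {1}` and `2 ≤ i ≤ n` (here: `i ≠ 0` in `Fin n`, index `0` playing the role of `1`),
is a free basis of `ker π`: the induced homomorphism from the free group on the index set to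
`ker π` is an isomorphism. -/
theorem stmt_1 (n : ℕ) (hn : 1 ≤ n) (A : Type*) [Group A] [Finite A]
    (π : Monoid.CoprodI (fun _ : Fin n => A) →* A)
    (hπ : ∀ (i : Fin n) (a : A),
      π (Monoid.CoprodI.of (M := fun _ : Fin n => A) (i := i) a) = a) :
    Function.Bijective
      (FreeGroup.lift (fun p : {a : A // a ≠ 1} × {i : Fin n // i ≠ ⟨0, hn⟩} =>
        (⟨(Monoid.CoprodI.of (M := fun _ : Fin n => A) (i := ⟨0, hn⟩) p.1.val)⁻¹ *
            Monoid.CoprodI.of (M := fun _ : Fin n => A) (i := p.2.val) p.1.val,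
          by simp [MonoidHom.mem_ker, hπ]⟩ : π.ker))) := by
  exact Stmt1.main _ π hπ _ (fun _ => rfl)
end

section
/- Let n ≥ 1, let C₂ be the cyclic group of order 2 with nontrivial element c, let W_n be the free product of n copies of C₂ with canonical injections ι_i, and write a_i = ι_i(c). Let π : W_n → C₂ be the homomorphism with π(a_i) = c for all i, and F = ker π. Then F is a characteristic subgroup of W_n: for every automorphism Φ of W_n, Φ(F) = F. -/
open Monoid in
theorem aux_invol {ι : Type*} {C : Type*} [Group C] (c : C) (hc : c ≠ 1)
    (hcc : c * c = 1) (hall : ∀ x : C, x ≠ 1 → x = c)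
    (π : CoprodI (fun _ : ι => C) →* C)
    (hπ : ∀ i : ι, π (CoprodI.of (M := fun _ : ι => C) (i := i) c) = c)
    (g : CoprodI (fun _ : ι => C)) (hg : g * g = 1) (hπg : π g = 1) : g = 1 := by
  classical
  obtain ⟨w, rfl⟩ : ∃ w : CoprodI.Word (fun _ : ι => C), w.prod = g :=
    ⟨CoprodI.Word.equiv g, CoprodI.Word.equiv.symm_apply_apply g⟩
  have hinv : c⁻¹ = c := inv_eq_of_mul_eq_one_left hcc
  -- the reversed word
  let r : CoprodI.Word (fun _ : ι => C) :=
    { toList := w.toList.reverse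
      ne_one := fun l hl => w.ne_one l (List.mem_reverse.1 hl)
      chain_ne := by
        rw [List.isChain_reverse]
        exact w.chain_ne.imp fun a b h => h.symm }
  have hr : r.prod = w.prod⁻¹ := by
    simp only [CoprodI.Word.prod, r, List.prod_inv_reverse, List.map_reverse, List.map_map]
    congr 2
    apply List.map_congr_left
    intro l hl
    have h := hall l.2 (w.ne_one l hl)
    simp only [Function.comp]
    rw [← map_inv, h, hinv]
  have hrw : r = w := by
    apply CoprodI.Word.equiv.symm.injective
    change r.prod = w.prod
    rw [hr]
    exact inv_eq_of_mul_eq_one_left hg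
  have hpal : w.toList.reverse = w.toList := congrArg CoprodI.Word.toList hrw
  have hlen : ∀ L : List (Σ _ : ι, C), (∀ l ∈ L, l.2 ≠ 1) →
      π ((L.map fun l => (CoprodI.of (M := fun _ : ι => C) (i := l.1) l.2)).prod)
        = c ^ L.length := by
    intro L
    induction L with
    | nil => intro _; simp
    | cons a L ih =>
      intro h
      have h1 := hall a.2 (h a (by simp))
      rw [List.map_cons, List.prod_cons, map_mul, ih (fun l hl => h l (by simp [hl])), h1, hπ,
        List.length_cons, pow_succ']
  have hl := hlen w.toList w.ne_one
  have hl2 : c ^ w.toList.length = 1 := hl.symm.trans hπg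
  rcases Nat.even_or_odd' w.toList.length with ⟨k, hk | hk⟩
  · rcases Nat.eq_zero_or_pos k with h0 | h0
    · have : w.toList = [] := List.length_eq_zero_iff.1 (by omega)
      simp [CoprodI.Word.prod, this]
    · exfalso
      have h1 := List.isChain_iff_getElem.1 w.chain_ne (k-1) (by omega)
      apply h1
      have h2 : w.toList[k-1]'(by omega) = w.toList.reverse[k-1]'(by simp; omega) := by
        simp only [hpal]
      rw [h2, List.getElem_reverse]
      congr 2
      omega
  · exfalso
    rw [hk, pow_succ, pow_mul, pow_two, hcc, one_pow, one_mul] at hl2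
    exact hc hl2

/-- Let `n ≥ 1`, `C` the cyclic group of order 2 with nontrivial element `c`,
`W_n` the free product of `n` copies of `C` (with `a_i = ι_i(c)`), and `π : W_n → C` the
homomorphism with `π(a_i) = c` for all `i`. Then `F = ker π` is characteristic: every
automorphism `Φ` of `W_n` satisfies `Φ(F) = F`. -/
theorem stmt_4 (n : ℕ) (hn : 1 ≤ n) (C : Type*) [Group C] (hC : Nat.card C = 2)
    (c : C) (hc : c ≠ 1)
    (π : Monoid.CoprodI (fun _ : Fin n => C) →* C)
    (hπ : ∀ i : Fin n, π (Monoid.CoprodI.of (M := fun _ : Fin n => C) (i := i) c) = c)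
    (Φ : Monoid.CoprodI (fun _ : Fin n => C) ≃* Monoid.CoprodI (fun _ : Fin n => C)) :
    Subgroup.map Φ.toMonoidHom π.ker = π.ker := by
  have hall : ∀ x : C, x ≠ 1 → x = c := by
    intro x hx
    obtain ⟨y, hy, hu⟩ := (Nat.card_eq_two_iff' (1 : C)).1 hC
    exact (hu x hx).trans (hu c hc).symm
  have hcc : c * c = 1 := by
    by_contra h
    exact hc (by simpa using hall _ h)
  have key : π.comp Φ.toMonoidHom = π := by
    apply Monoid.CoprodI.ext_hom
    intro i
    ext x
    by_cases hx : x = 1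
    · simp [hx]
    · rw [hall x hx]
      change π (Φ (Monoid.CoprodI.of c)) = π (Monoid.CoprodI.of c)
      rw [hπ]
      apply hall
      intro h
      have h1 := aux_invol c hc hcc hall π hπ _ (by rw [← map_mul, ← map_mul, hcc]; simp) h
      rw [EmbeddingLike.map_eq_one_iff] at h1
      have h2 := hπ i
      rw [h1, map_one] at h2
      exact hc h2.symm
  have key' : ∀ x, π (Φ x) = π x := fun x => DFunLike.congr_fun key x
  ext y
  simp only [Subgroup.mem_map, MonoidHom.mem_ker]
  constructor
  · rintro ⟨x, hx, rfl⟩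
    exact (key' x).trans hx
  · intro hy
    refine ⟨Φ.symm y, ?_, by simp⟩
    rw [← key']
    simpa using hy
end

section
/- Let n ≥ 3, let C₂ be the cyclic group of order 2 with nontrivial element c, let W_n be the free product of n copies of C₂ with canonical injections ι_i, write a_i = ι_i(c), let π : W_n → C₂ be the homomorphism with π(a_i) = c for all i, and let F = ker π. Then the restriction homomorphism ρ : Aut(W_n) → Aut(F), Φ ↦ Φ|_F, is injective: if an automorphism Φ of W_n fixes every element of F, then Φ is the identity automorphism of W_n. -/
open Monoid.CoprodI in
/-- Two nonempty reduced words with the same product begin with the same index. -/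
theorem neWord_fst_eq {ι : Type*} {M : ι → Type*} [∀ i, Monoid (M i)]
    {i j k l : ι} (v : NeWord M i j) (w : NeWord M k l) (h : v.prod = w.prod) : i = k := by
  classical
  have h1 : v.toWord = w.toWord := by
    apply (Word.equiv (M := M)).symm.injective
    exact h
  have h2 : v.toList = w.toList := congrArg Word.toList h1
  have h3 := v.toList_head?
  rw [h2, w.toList_head?] at h3
  exact (congrArg Sigma.fst (Option.some.inj h3)).symm

/-- In a finite type of size at least three one can avoid two elements. -/
theorem exists_avoid (n : ℕ) (hn : 3 ≤ n) (i j : Fin n) : ∃ p : Fin n, p ≠ i ∧ p ≠ j := by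
  have h : ({i, j} : Finset (Fin n)).card < Fintype.card (Fin n) := by
    have := Finset.card_le_two (a := i) (b := j)
    simp only [Fintype.card_fin]
    omega
  obtain ⟨p, hp⟩ := Finset.exists_mem_notMem_of_card_lt_card (s := {i, j}) (t := Finset.univ) h
  exact ⟨p, by simpa using hp⟩

open Monoid.CoprodI in
/-- An element commuting with all products of two distinct generators is trivial. -/
theorem central_trivial (n : ℕ) (hn : 3 ≤ n) (C : Type*) [Group C] (c : C) (hc : c ≠ 1)
    (z : Monoid.CoprodI (fun _ : Fin n => C))
    (hz : ∀ p q : Fin n, z * (of (M := fun _ : Fin n => C) (i := p) c *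
      of (M := fun _ : Fin n => C) (i := q) c) = (of (M := fun _ : Fin n => C) (i := p) c *
      of (M := fun _ : Fin n => C) (i := q) c) * z) : z = 1 := by
  classical
  by_contra hne
  obtain ⟨w, rfl⟩ := (Word.equiv (M := fun _ : Fin n => C)).symm.surjective z
  have hw : w ≠ Word.empty := by
    rintro rfl
    exact hne Word.prod_empty
  obtain ⟨i, j, v, rfl⟩ := NeWord.of_word w hw
  obtain ⟨p, hpi, hpj⟩ := exists_avoid n hn i j
  obtain ⟨q, hqi, hqp⟩ := exists_avoid n hn i p
  let x : NeWord (fun _ : Fin n => C) p q :=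
    NeWord.append (NeWord.singleton c hc) hqp.symm (NeWord.singleton c hc)
  have hx : x.prod = of (M := fun _ : Fin n => C) (i := p) c *
      of (M := fun _ : Fin n => C) (i := q) c := by
    simp [x]
  have h := hz p q
  rw [← hx] at h
  change v.prod * x.prod = x.prod * v.prod at h
  refine hpi (neWord_fst_eq (NeWord.append v hpj.symm x) (NeWord.append x hqi v) ?_).symm
  exact NeWord.append_prod.trans (h.trans NeWord.append_prod.symm)

/-- Let `n ≥ 3`, `C` the cyclic group of order 2 with nontrivial element `c`,
`W_n` the free product of `n` copies of `C` (with `a_i = ι_i(c)`), `π : W_n → C` the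
homomorphism with `π(a_i) = c` for all `i`, and `F = ker π`. The restriction homomorphism
`Aut(W_n) → Aut(F)` is injective: if an automorphism `Φ` of `W_n` fixes every element of `F`,
then `Φ` is the identity. -/
theorem stmt_5 (n : ℕ) (hn : 3 ≤ n) (C : Type*) [Group C] (hC : Nat.card C = 2)
    (c : C) (hc : c ≠ 1)
    (π : Monoid.CoprodI (fun _ : Fin n => C) →* C)
    (hπ : ∀ i : Fin n, π (Monoid.CoprodI.of (M := fun _ : Fin n => C) (i := i) c) = c)
    (Φ : Monoid.CoprodI (fun _ : Fin n => C) ≃* Monoid.CoprodI (fun _ : Fin n => C))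
    (hΦ : ∀ x ∈ π.ker, Φ x = x) :
    ∀ x : Monoid.CoprodI (fun _ : Fin n => C), Φ x = x := by
  have hC2 : ∀ y : C, y = 1 ∨ y = c := by
    have hf : Finite C := Nat.finite_of_card_ne_zero (by omega)
    intro y
    by_contra! hy
    have h3 : ({1, c, y} : Set C).ncard = 3 := by
      rw [Set.ncard_eq_three]
      exact ⟨1, c, y, hc.symm, hy.1.symm, hy.2.symm, rfl⟩
    have := Set.ncard_le_card ({1, c, y} : Set C)
    omega
  have hcc : c * c = 1 := by
    rcases hC2 (c * c) with h | h
    · exact h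
    · exact absurd (mul_eq_left.mp h) hc
  have key : ∀ i : Fin n, Φ (Monoid.CoprodI.of (M := fun _ : Fin n => C) (i := i) c) =
      Monoid.CoprodI.of (M := fun _ : Fin n => C) (i := i) c := by
    intro i
    set a := Monoid.CoprodI.of (M := fun _ : Fin n => C) (i := i) c with ha
    have hz : a⁻¹ * Φ a = 1 := by
      apply central_trivial n hn C c hc
      intro p q
      set x := Monoid.CoprodI.of (M := fun _ : Fin n => C) (i := p) c *
        Monoid.CoprodI.of (M := fun _ : Fin n => C) (i := q) c with hx
      have hxk : x ∈ π.ker := by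
        rw [MonoidHom.mem_ker, hx, map_mul, hπ, hπ, hcc]
      have h1 := hΦ x hxk
      have h2 := hΦ (a * x * a⁻¹) (π.normal_ker.conj_mem x hxk a)
      rw [map_mul, map_mul, map_inv, h1] at h2
      have h3 : Φ a * x = a * x * a⁻¹ * Φ a := by
        rw [← h2]; group
      rw [mul_assoc, h3]; group
    exact (inv_mul_eq_one.mp hz).symm
  intro x
  induction x using Monoid.CoprodI.induction_on with
  | one => exact map_one Φ
  | of i m =>
    rcases hC2 m with rfl | rfl
    · simp
    · exact key i
  | mul x y hx hy => rw [map_mul, hx, hy]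
end

section
/- Let A be a finite abelian group and let W = A ∗ A be the free product of two copies of A, with canonical injections ι_1, ι_2 : A → W. Suppose Φ is an automorphism of W such that there exist elements w_1, w_2 ∈ W with Φ(ι_i(a)) = w_i⁻¹ · ι_i(a) · w_i for all a ∈ A and i = 1, 2. Then Φ is an inner automorphism of W: there exists w ∈ W with Φ(x) = w⁻¹ x w for all x ∈ W. (In other words, Out⁰(A ∗ A) is trivial.) -/
open Monoid in
/-- The binary free product as an indexed free product over `Bool`. -/
noncomputable def coprodEquivI (A : Type*) [CommGroup A] :
    Monoid.Coprod A A ≃* CoprodI (fun _ : Bool => A) :=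
  MonoidHom.toMulEquiv
    (Monoid.Coprod.lift (CoprodI.of (M := fun _ : Bool => A) (i := false))
      (CoprodI.of (M := fun _ : Bool => A) (i := true)))
    (CoprodI.lift (fun b : Bool => match b with
      | false => (Monoid.Coprod.inl : A →* Monoid.Coprod A A)
      | true => (Monoid.Coprod.inr : A →* Monoid.Coprod A A)))
    (by ext <;> simp)
    (by
      apply CoprodI.ext_hom
      intro b
      cases b <;> ext <;> simp)

open Monoid CoprodI in
/-- Split off the last letter of a nonempty reduced word. -/
theorem neWord_split {A : Type*} [CommGroup A] {i j : Bool}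
    (w : NeWord (fun _ : Bool => A) i j) :
    (i = j ∧ ∃ x : A, w.prod = of (M := fun _ : Bool => A) (i := j) x) ∨
    ∃ (k : Bool) (_ : k ≠ j) (w' : NeWord (fun _ : Bool => A) i k) (x : A),
      w.prod = w'.prod * of (M := fun _ : Bool => A) (i := j) x := by
  induction w with
  | singleton x hx => exact Or.inl ⟨rfl, x, by simp⟩
  | append w₁ hne w₂ ih₁ ih₂ =>
    right
    rcases ih₂ with ⟨h, x, hx⟩ | ⟨k, hk, w', x, hx⟩
    · subst h
      exact ⟨_, hne, w₁, x, by simp [hx]⟩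
    · exact ⟨k, hk, w₁.append hne w', x, by simp [hx, mul_assoc]⟩

open Monoid CoprodI in
theorem exists_neWord {A : Type*} [CommGroup A] (u : CoprodI (fun _ : Bool => A)) :
    u = 1 ∨ ∃ (i j : Bool) (w : NeWord (fun _ : Bool => A) i j), w.prod = u := by
  classical
  by_cases h : Word.equiv u = Word.empty
  · left
    have := congrArg Word.equiv.symm h
    rw [Equiv.symm_apply_apply] at this
    rw [this]; exact Word.prod_empty
  · right
    obtain ⟨i, j, w, hw⟩ := NeWord.of_word _ h
    refine ⟨i, j, w, ?_⟩
    have : Word.equiv.symm (Word.equiv u) = u := Equiv.symm_apply_apply _ _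
    rw [← this, ← hw]; rfl

open Monoid CoprodI in
theorem decomp {A : Type*} [CommGroup A] (u : CoprodI (fun _ : Bool => A)) :
    ∃ (b c : A) (v : CoprodI (fun _ : Bool => A)),
      u = of (M := fun _ : Bool => A) (i := true) b * v
        * of (M := fun _ : Bool => A) (i := false) c ∧
      (v = 1 ∨ ∃ w : NeWord (fun _ : Bool => A) false true, w.prod = v) := by
  classical
  let p := Word.equivPair true (Word.equiv u)
  have hu : u = of (M := fun _ : Bool => A) (i := true) p.head * p.tail.prod := by
    rw [← Word.prod_rcons, ← Word.equivPair_symm, Equiv.symm_apply_apply]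
    exact (Equiv.symm_apply_apply Word.equiv u).symm
  by_cases h : p.tail = Word.empty
  · exact ⟨p.head, 1, 1, by rw [hu, h]; simp, Or.inl rfl⟩
  · obtain ⟨i, j, w, hw⟩ := NeWord.of_word _ h
    have hi : i = false := by
      have h1 := p.fstIdx_ne
      rw [← hw] at h1
      have h2 : w.toWord.fstIdx = some i := by
        simp [Word.fstIdx, NeWord.toWord, NeWord.toList_head?]
      rw [h2] at h1
      simpa using h1
    subst hi
    have hw' : p.tail.prod = w.prod := by rw [← hw]; rfl
    rw [hw'] at hu
    cases j with
    | true => exact ⟨p.head, 1, w.prod, by rw [map_one, mul_one]; exact hu, Or.inr ⟨w, rfl⟩⟩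
    | false =>
      rcases neWord_split w with ⟨_, x, hx⟩ | ⟨k, hk, w', x, hx⟩
      · exact ⟨p.head, x, 1, by rw [mul_one, ← hx]; exact hu, Or.inl rfl⟩
      · have : k = true := by simpa using hk
        subst this
        exact ⟨p.head, x, w'.prod, by rw [mul_assoc, ← hx]; exact hu, Or.inr ⟨w', rfl⟩⟩

open Monoid CoprodI in
theorem image_word {A : Type*} [CommGroup A]
    (f : CoprodI (fun _ : Bool => A) →* CoprodI (fun _ : Bool => A))
    (v : NeWord (fun _ : Bool => A) false true)
    (h₁ : ∀ a : A, f (of (M := fun _ : Bool => A) (i := false) a)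
      = of (M := fun _ : Bool => A) (i := false) a)
    (h₂ : ∀ a : A, f (of (M := fun _ : Bool => A) (i := true) a)
      = v.prod⁻¹ * of (M := fun _ : Bool => A) (i := true) a * v.prod)
    {i j : Bool} (w : NeWord (fun _ : Bool => A) i j) :
    ∃ w' : NeWord (fun _ : Bool => A) i j, w'.prod = f w.prod ∧
      (2 ≤ w'.toList.length ∨ i = false) := by
  have pos : ∀ {i j : Bool} (w : NeWord (fun _ : Bool => A) i j), 1 ≤ w.toList.length :=
    fun w => List.length_pos_iff.2 w.toList_ne_nil
  induction w with
  | @singleton i x hx =>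
    cases i with
    | false => exact ⟨.singleton x hx, by simp [h₁], Or.inr rfl⟩
    | true =>
      refine ⟨(v.inv.append (by simp) (.singleton (i := true) x hx)).append (by simp) v, ?_, ?_⟩
      · simp [h₂]
      · left
        have := pos v
        simp only [NeWord.toList, List.length_append, List.length_singleton]
        omega
  | append w₁ hne w₂ ih₁ ih₂ =>
    obtain ⟨a, ha, -⟩ := ih₁
    obtain ⟨b, hb, -⟩ := ih₂
    refine ⟨a.append hne b, by simp [ha, hb], Or.inl ?_⟩
    have := pos a
    have := pos b
    simp only [NeWord.toList, List.length_append]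
    omega

open Monoid CoprodI in
theorem not_surj {A : Type*} [CommGroup A]
    (f : CoprodI (fun _ : Bool => A) →* CoprodI (fun _ : Bool => A))
    (hf : Function.Surjective f)
    (v : NeWord (fun _ : Bool => A) false true)
    (h₁ : ∀ a : A, f (of (M := fun _ : Bool => A) (i := false) a)
      = of (M := fun _ : Bool => A) (i := false) a)
    (h₂ : ∀ a : A, f (of (M := fun _ : Bool => A) (i := true) a)
      = v.prod⁻¹ * of (M := fun _ : Bool => A) (i := true) a * v.prod)
    (b : A) (hb : b ≠ 1) : False := by
  classical
  obtain ⟨x, hx⟩ := hf (of (M := fun _ : Bool => A) (i := true) b)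
  rcases exists_neWord x with rfl | ⟨i, j, w, rfl⟩
  · rw [map_one, ← map_one (of (M := fun _ : Bool => A) (i := true))] at hx
    exact hb (of_injective (M := fun _ : Bool => A) true hx).symm
  · obtain ⟨w', hw', hl⟩ := image_word f v h₁ h₂ w
    have h : w'.prod = (NeWord.singleton (M := fun _ : Bool => A) (i := true) b hb).prod := by
      rw [hw', hx, NeWord.prod_singleton]
    have h' : w'.toWord
        = (NeWord.singleton (M := fun _ : Bool => A) (i := true) b hb).toWord :=
      Word.equiv.symm.injective h
    have h'' : w'.toList = [⟨true, b⟩] := congrArg Word.toList h'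
    rcases hl with hl | rfl
    · rw [h''] at hl; simp at hl
    · have := w'.toList_head?
      rw [h''] at this
      simp at this

open Monoid CoprodI in
theorem main_I {A : Type*} [CommGroup A]
    (Φ : CoprodI (fun _ : Bool => A) ≃* CoprodI (fun _ : Bool => A))
    (w₁ w₂ : CoprodI (fun _ : Bool => A))
    (h₁ : ∀ a : A, Φ (of (M := fun _ : Bool => A) (i := false) a)
      = w₁⁻¹ * of (M := fun _ : Bool => A) (i := false) a * w₁)
    (h₂ : ∀ a : A, Φ (of (M := fun _ : Bool => A) (i := true) a)
      = w₂⁻¹ * of (M := fun _ : Bool => A) (i := true) a * w₂) :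
    ∃ w, ∀ x, Φ x = w⁻¹ * x * w := by
  obtain ⟨b, c, v, hu, hv⟩ := decomp (w₂ * w₁⁻¹)
  set B := of (M := fun _ : Bool => A) (i := true) b with hB
  set C := of (M := fun _ : Bool => A) (i := false) c with hC
  have hw₂ : w₂ = B * v * C * w₁ := by rw [← hu]; group
  let Ψ : CoprodI (fun _ : Bool => A) ≃* CoprodI (fun _ : Bool => A) :=
    Φ.trans (MulAut.conj (C * w₁))
  have hΨ : ∀ x, Ψ x = (C * w₁) * Φ x * (C * w₁)⁻¹ := fun x => rfl
  have e₁ : ∀ a : A, Ψ (of (M := fun _ : Bool => A) (i := false) a)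
      = of (M := fun _ : Bool => A) (i := false) a := by
    intro a
    have hc : C * of (M := fun _ : Bool => A) (i := false) a
        = of (M := fun _ : Bool => A) (i := false) a * C := by
      rw [hC, ← map_mul, ← map_mul, mul_comm]
    rw [hΨ, h₁]
    calc _ = C * of (M := fun _ : Bool => A) (i := false) a * C⁻¹ := by group
      _ = _ := by rw [hc]; group
  have e₂ : ∀ a : A, Ψ (of (M := fun _ : Bool => A) (i := true) a)
      = v⁻¹ * of (M := fun _ : Bool => A) (i := true) a * v := by
    intro a
    have hc : of (M := fun _ : Bool => A) (i := true) a * B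
        = B * of (M := fun _ : Bool => A) (i := true) a := by
      rw [hB, ← map_mul, ← map_mul, mul_comm]
    rw [hΨ, h₂, hw₂]
    calc _ = v⁻¹ * B⁻¹ * (of (M := fun _ : Bool => A) (i := true) a * B) * v := by group
      _ = _ := by rw [hc]; group
  have key : ∀ x, Ψ x = x := by
    by_cases hA : ∀ a : A, a = 1
    · have : Ψ.toMonoidHom = MonoidHom.id _ := by
        apply CoprodI.ext_hom
        intro i
        ext a
        rw [hA a, map_one, map_one]
      exact fun x => DFunLike.congr_fun this x
    · push Not at hA
      obtain ⟨a, ha⟩ := hA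
      rcases hv with rfl | ⟨w, rfl⟩
      · have : Ψ.toMonoidHom = MonoidHom.id _ := by
          apply CoprodI.ext_hom
          intro i
          ext a
          cases i with
          | false => exact e₁ a
          | true => exact (e₂ a).trans (by simp)
        exact fun x => DFunLike.congr_fun this x
      · exact (not_surj Ψ.toMonoidHom Ψ.surjective w e₁ e₂ a ha).elim
  refine ⟨C * w₁, fun x => ?_⟩
  have := key x
  rw [hΨ] at this
  calc Φ x = (C * w₁)⁻¹ * ((C * w₁) * Φ x * (C * w₁)⁻¹) * (C * w₁) := by group
    _ = _ := by rw [this]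


/-- Let `A` be a finite abelian group and `W = A ∗ A` the free product of two
copies of `A`. If `Φ` is an automorphism of `W` conjugating each factor by a fixed element
(`Φ(ι_i(a)) = w_i⁻¹ ι_i(a) w_i`), then `Φ` is inner. (`Out⁰(A ∗ A)` is trivial.) -/
theorem stmt_6 (A : Type*) [CommGroup A] [Finite A]
    (Φ : Monoid.Coprod A A ≃* Monoid.Coprod A A)
    (w₁ w₂ : Monoid.Coprod A A)
    (h₁ : ∀ a : A, Φ (Monoid.Coprod.inl a) = w₁⁻¹ * Monoid.Coprod.inl a * w₁)
    (h₂ : ∀ a : A, Φ (Monoid.Coprod.inr a) = w₂⁻¹ * Monoid.Coprod.inr a * w₂) :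
    ∃ w : Monoid.Coprod A A, ∀ x : Monoid.Coprod A A, Φ x = w⁻¹ * x * w := by

  let e := coprodEquivI A
  have el : ∀ a : A, e (Monoid.Coprod.inl a)
      = Monoid.CoprodI.of (M := fun _ : Bool => A) (i := false) a := fun a => by
    simp [e, coprodEquivI]
  have er : ∀ a : A, e (Monoid.Coprod.inr a)
      = Monoid.CoprodI.of (M := fun _ : Bool => A) (i := true) a := fun a => by
    simp [e, coprodEquivI]
  obtain ⟨w, hw⟩ := main_I ((e.symm.trans Φ).trans e) (e w₁) (e w₂)
    (fun a => by
      rw [← el]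
      simp only [MulEquiv.trans_apply, MulEquiv.symm_apply_apply, h₁, map_mul, map_inv])
    (fun a => by
      rw [← er]
      simp only [MulEquiv.trans_apply, MulEquiv.symm_apply_apply, h₂, map_mul, map_inv])
  refine ⟨e.symm w, fun x => ?_⟩
  have := congrArg e.symm (hw (e x))
  simpa using this
end

section
/- Let H_1 and H_2 be groups with automorphisms Φ_1 ∈ Aut(H_1) and Φ_2 ∈ Aut(H_2), and let Φ = Φ_1 ∗ Φ_2 be the induced automorphism of the free product H_1 ∗ H_2 (the automorphism restricting to Φ_i on each factor). Then the mapping torus (H_1 ∗ H_2) ⋊_Φ ℤ is isomorphic to the amalgamated free product (H_1 ⋊_{Φ_1} ℤ) ∗_ℤ (H_2 ⋊_{Φ_2} ℤ), where ℤ maps into each mapping torus H_i ⋊_{Φ_i} ℤ as its ℤ-factor (n ↦ (1, n)). -/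
/-- The mapping torus `G ⋊_Φ ℤ` of an automorphism `Φ` of `G`: the semidirect product of `G`
by `ℤ` in which the generator `t` of `ℤ` acts by `t g t⁻¹ = Φ(g)`. -/
abbrev mappingTorus {G : Type*} [Group G] (Φ : MulAut G) :=
  G ⋊[zpowersHom (MulAut G) Φ] Multiplicative ℤ

universe u

/-- A two-member family of types indexed by `Bool`. -/
def boolFam (X Y : Type u) : Bool → Type u
  | true => X
  | false => Y

instance boolFam.instGroup (X Y : Type u) [Group X] [Group Y] :
    (b : Bool) → Group (boolFam X Y b)
  | true => ‹Group X›
  | false => ‹Group Y›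

/-- A two-member family of homomorphisms out of a common source, indexed by `Bool`. -/
def boolHom {X Y : Type u} [Group X] [Group Y] {H : Type*} [Group H]
    (f : H →* X) (g : H →* Y) : (b : Bool) → H →* boolFam X Y b
  | true => f
  | false => g

theorem zpow_intertwine {N M : Type*} [Group N] [Group M] (f : N →* M) (A : MulAut N)
    (B : MulAut M) (h : ∀ x, B (f x) = f (A x)) (n : ℤ) (x : N) :
    (B ^ n) (f x) = f ((A ^ n) x) := by
  have hinv : ∀ x, B⁻¹ (f x) = f (A⁻¹ x) := by
    intro x
    apply B.injective
    rw [MulAut.apply_inv_self, h, MulAut.apply_inv_self]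
  induction n generalizing x with
  | zero => simp
  | succ n ih => rw [zpow_add_one, zpow_add_one, MulAut.mul_apply, MulAut.mul_apply, h, ih]
  | pred n ih => rw [zpow_sub_one, zpow_sub_one, MulAut.mul_apply, MulAut.mul_apply, hinv, ih]

/-- The map of mapping tori induced by an equivariant homomorphism. -/
def mapTorusAux {N M : Type*} [Group N] [Group M] (f : N →* M) (A : MulAut N)
    (B : MulAut M) (h : ∀ x, B (f x) = f (A x)) : mappingTorus A →* mappingTorus B :=
  SemidirectProduct.map f (MonoidHom.id _) (fun g => by
    ext x
    simpa using (zpow_intertwine f A B h g.toAdd x).symm)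

/-- A two-member family of homomorphisms into a common target. -/
def boolOut {X Y : Type u} [Group X] [Group Y] {K : Type*} [Group K]
    (f : X →* K) (g : Y →* K) : (b : Bool) → boolFam X Y b →* K
  | true => f
  | false => g

section
variable {X Y : Type u} [Group X] [Group Y] {H : Type*} [Group H] (f : H →* X) (g : H →* Y)

/-- First structure map of the pushout. -/
def pin₁ : X →* Monoid.PushoutI (boolHom f g) :=
  Monoid.PushoutI.of (φ := boolHom f g) true
/-- Second structure map of the pushout. -/
def pin₂ : Y →* Monoid.PushoutI (boolHom f g) :=
  Monoid.PushoutI.of (φ := boolHom f g) false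

theorem pin₁_apply (x : H) : pin₁ f g (f x) = Monoid.PushoutI.base (boolHom f g) x :=
  Monoid.PushoutI.of_apply_eq_base (boolHom f g) true x
theorem pin₂_apply (x : H) : pin₂ f g (g x) = Monoid.PushoutI.base (boolHom f g) x :=
  Monoid.PushoutI.of_apply_eq_base (boolHom f g) false x

/-- The universal property. -/
def pdesc {K : Type*} [Group K] (a : X →* K) (b : Y →* K) (k : H →* K)
    (ha : a.comp f = k) (hb : b.comp g = k) : Monoid.PushoutI (boolHom f g) →* K :=
  Monoid.PushoutI.lift (boolOut a b) k (by rintro (_ | _); exacts [hb, ha])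

variable {f g}
theorem pdesc_pin₁ {K : Type*} [Group K] (a : X →* K) (b : Y →* K) (k : H →* K)
    (ha : a.comp f = k) (hb : b.comp g = k) (x : X) :
    pdesc f g a b k ha hb (pin₁ f g x) = a x :=
  Monoid.PushoutI.lift_of (φ := boolHom f g) (boolOut a b) k _ (i := true) x
theorem pdesc_pin₂ {K : Type*} [Group K] (a : X →* K) (b : Y →* K) (k : H →* K)
    (ha : a.comp f = k) (hb : b.comp g = k) (x : Y) :
    pdesc f g a b k ha hb (pin₂ f g x) = b x :=
  Monoid.PushoutI.lift_of (φ := boolHom f g) (boolOut a b) k _ (i := false) x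
theorem pdesc_base {K : Type*} [Group K] (a : X →* K) (b : Y →* K) (k : H →* K)
    (ha : a.comp f = k) (hb : b.comp g = k) (x : H) :
    pdesc f g a b k ha hb (Monoid.PushoutI.base _ x) = k x :=
  Monoid.PushoutI.lift_base _ _ _ _

theorem push_ext {K : Type*} [Group K] {p q : Monoid.PushoutI (boolHom f g) →* K}
    (h₁ : p.comp (pin₁ f g) = q.comp (pin₁ f g)) (h₂ : p.comp (pin₂ f g) = q.comp (pin₂ f g)) :
    p = q :=
  Monoid.PushoutI.hom_ext_nonempty (by rintro (_ | _); exacts [h₂, h₁])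
end

/-- Let `Φ₁ ∈ Aut(H₁)`, `Φ₂ ∈ Aut(H₂)`, and let `Φ = Φ₁ ∗ Φ₂` be the induced
automorphism of the free product `H₁ ∗ H₂`. Then the mapping torus `(H₁ ∗ H₂) ⋊_Φ ℤ` is
isomorphic to the amalgamated free product (pushout) of the two mapping tori `H_i ⋊_{Φ_i} ℤ`
over `ℤ`, where `ℤ` maps into each mapping torus as its `ℤ`-factor `n ↦ (1, n)`. -/
theorem stmt_9 {H₁ H₂ : Type u} [Group H₁] [Group H₂]
    (Φ₁ : MulAut H₁) (Φ₂ : MulAut H₂)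
    (Φ : MulAut (Monoid.Coprod H₁ H₂))
    (hl : ∀ h : H₁, Φ (Monoid.Coprod.inl h) = Monoid.Coprod.inl (Φ₁ h))
    (hr : ∀ h : H₂, Φ (Monoid.Coprod.inr h) = Monoid.Coprod.inr (Φ₂ h)) :
    Nonempty (mappingTorus Φ ≃*
      Monoid.PushoutI
        (boolHom (X := mappingTorus Φ₁) (Y := mappingTorus Φ₂)
          SemidirectProduct.inr SemidirectProduct.inr)) := by
  let s₁ : Multiplicative ℤ →* mappingTorus Φ₁ := SemidirectProduct.inr
  let s₂ : Multiplicative ℤ →* mappingTorus Φ₂ := SemidirectProduct.inr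
  have e₁ : ∀ (n : Multiplicative ℤ) (x : H₁),
      pin₁ s₁ s₂ (SemidirectProduct.inl (zpowersHom (MulAut H₁) Φ₁ n x)) =
        Monoid.PushoutI.base (boolHom s₁ s₂) n * pin₁ s₁ s₂ (SemidirectProduct.inl x) *
          (Monoid.PushoutI.base (boolHom s₁ s₂) n)⁻¹ := by
    intro n x
    rw [SemidirectProduct.inl_aut, map_mul, map_mul, ← map_inv, ← pin₁_apply s₁ s₂ n,
      ← pin₁_apply s₁ s₂ n⁻¹]
  have e₂ : ∀ (n : Multiplicative ℤ) (x : H₂),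
      pin₂ s₁ s₂ (SemidirectProduct.inl (zpowersHom (MulAut H₂) Φ₂ n x)) =
        Monoid.PushoutI.base (boolHom s₁ s₂) n * pin₂ s₁ s₂ (SemidirectProduct.inl x) *
          (Monoid.PushoutI.base (boolHom s₁ s₂) n)⁻¹ := by
    intro n x
    rw [SemidirectProduct.inl_aut, map_mul, map_mul, ← map_inv, ← pin₂_apply s₁ s₂ n,
      ← pin₂_apply s₁ s₂ n⁻¹]
  let F : mappingTorus Φ →* Monoid.PushoutI (boolHom s₁ s₂) :=
    SemidirectProduct.lift
      (Monoid.Coprod.lift ((pin₁ s₁ s₂).comp SemidirectProduct.inl)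
        ((pin₂ s₁ s₂).comp SemidirectProduct.inl))
      (Monoid.PushoutI.base (boolHom s₁ s₂)) (by
        intro n
        apply Monoid.Coprod.hom_ext
        · ext x
          have := zpow_intertwine Monoid.Coprod.inl Φ₁ Φ hl n.toAdd x
          have h2 := e₁ n x
          simp only [zpowersHom_apply] at h2
          simp [this, h2]
        · ext x
          have := zpow_intertwine Monoid.Coprod.inr Φ₂ Φ hr n.toAdd x
          have h2 := e₂ n x
          simp only [zpowersHom_apply] at h2
          simp [this, h2])
  let B : Monoid.PushoutI (boolHom s₁ s₂) →* mappingTorus Φ :=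
    pdesc s₁ s₂ (mapTorusAux Monoid.Coprod.inl Φ₁ Φ hl) (mapTorusAux Monoid.Coprod.inr Φ₂ Φ hr)
      SemidirectProduct.inr (by ext <;> simp [mapTorusAux, s₁]) (by ext <;> simp [mapTorusAux, s₂])
  refine ⟨MonoidHom.toMulEquiv F B ?_ ?_⟩
  · apply SemidirectProduct.hom_ext
    · apply Monoid.Coprod.hom_ext
      · apply MonoidHom.ext; intro x
        simp [F, B, pdesc_pin₁, mapTorusAux]
      · apply MonoidHom.ext; intro x
        simp [F, B, pdesc_pin₂, mapTorusAux]
    · apply MonoidHom.ext; intro x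
      simp [F, B, pdesc_base]
  · change F.comp B = MonoidHom.id (Monoid.PushoutI (boolHom s₁ s₂))
    apply push_ext (f := s₁) (g := s₂)
    · apply SemidirectProduct.hom_ext
      · apply MonoidHom.ext; intro x
        simp [F, B, pdesc_pin₁, mapTorusAux]
      · apply MonoidHom.ext; intro x
        simpa [F, B, pdesc_pin₁, mapTorusAux] using (pin₁_apply s₁ s₂ x).symm
    · apply SemidirectProduct.hom_ext
      · apply MonoidHom.ext; intro x
        simp [F, B, pdesc_pin₂, mapTorusAux]
      · apply MonoidHom.ext; intro x
        simpa [F, B, pdesc_pin₂, mapTorusAux] using (pin₂_apply s₁ s₂ x).symm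
end

section
/- Let H be a group and let G = H ∗ ℤ be the free product of H with the infinite cyclic group generated by x. Let Φ_1 ∈ Aut(H) and w ∈ H, and let Φ be the automorphism of G restricting to Φ_1 on H and satisfying Φ(x) = w⁻¹ x w. Then the mapping torus G ⋊_Φ ℤ is isomorphic to the HNN extension of H ⋊_{Φ_1} ℤ in which both associated subgroups are the cyclic subgroup generated by the element (w, 1) = w·t (where t denotes the generator of the ℤ-factor of H ⋊_{Φ_1} ℤ) and the associated isomorphism is the identity. -/
theorem mt_conj_zpow {G K : Type*} [Group G] [Group K] (Φ : MulAut G) (f : G →* K) (s : K)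
    (h : ∀ g, f (Φ g) = s * f g * s⁻¹) (n : ℤ) : ∀ g, f ((Φ ^ n) g) = s ^ n * f g * (s ^ n)⁻¹ := by
  have hinv : ∀ g, f (Φ⁻¹ g) = s⁻¹ * f g * s := by
    intro g
    have := h (Φ⁻¹ g)
    rw [MulAut.apply_inv_self] at this
    rw [this]; group
  induction n using Int.induction_on with
  | zero => intro g; simp
  | succ n ih =>
    intro g
    rw [zpow_add_one, MulAut.mul_apply, ih, h, zpow_add_one, mul_inv_rev]
    simp only [mul_assoc]
  | pred n ih =>
    intro g
    rw [zpow_sub_one, MulAut.mul_apply, ih, hinv, zpow_sub_one, mul_inv_rev, inv_inv]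
    simp only [mul_assoc]

/-- Universal property of the mapping torus. -/
def mtLift {G K : Type*} [Group G] [Group K] (Φ : MulAut G) (f : G →* K) (s : K)
    (h : ∀ g, f (Φ g) = s * f g * s⁻¹) : mappingTorus Φ →* K :=
  SemidirectProduct.lift f (zpowersHom K s) (by
    intro n
    ext g
    change f ((Φ ^ n.toAdd) g) = s ^ n.toAdd * f g * (s ^ n.toAdd)⁻¹
    exact mt_conj_zpow Φ f s h n.toAdd g)

@[simp] theorem mtLift_inl {G K : Type*} [Group G] [Group K] (Φ : MulAut G) (f : G →* K) (s : K)
    (h : ∀ g, f (Φ g) = s * f g * s⁻¹) (g : G) :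
    mtLift Φ f s h (SemidirectProduct.inl g) = f g := by
  simp [mtLift]

@[simp] theorem mtLift_inr {G K : Type*} [Group G] [Group K] (Φ : MulAut G) (f : G →* K) (s : K)
    (h : ∀ g, f (Φ g) = s * f g * s⁻¹) :
    mtLift Φ f s h (SemidirectProduct.inr (Multiplicative.ofAdd 1)) = s := by
  simp [mtLift]

theorem mt_conj {G : Type*} [Group G] (Φ : MulAut G) (g : G) :
    (SemidirectProduct.inl (Φ g) : mappingTorus Φ) =
      SemidirectProduct.inr (Multiplicative.ofAdd 1) * SemidirectProduct.inl g *
        (SemidirectProduct.inr (Multiplicative.ofAdd 1))⁻¹ := by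
  have := SemidirectProduct.inl_aut (φ := zpowersHom (MulAut G) Φ) (Multiplicative.ofAdd 1) g
  simpa using this

theorem mt_hom_ext {G K : Type*} [Group G] [Group K] {Φ : MulAut G} {f g : mappingTorus Φ →* K}
    (h : ∀ x, f (SemidirectProduct.inl x) = g (SemidirectProduct.inl x))
    (ht : f (SemidirectProduct.inr (Multiplicative.ofAdd 1)) =
      g (SemidirectProduct.inr (Multiplicative.ofAdd 1))) : f = g :=
  SemidirectProduct.hom_ext (MonoidHom.ext h) (MonoidHom.ext_mint ht)

/-- Let `G = H ∗ ℤ` be the free product of `H` with the infinite cyclic group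
generated by `x`, and let `Φ` be the automorphism of `G` restricting to `Φ₁` on `H` and with
`Φ(x) = w⁻¹ x w` for some `w ∈ H`. Then the mapping torus `G ⋊_Φ ℤ` is isomorphic to the HNN
extension of `H ⋊_{Φ₁} ℤ` whose two associated subgroups are both the cyclic subgroup
generated by `w·t`, with the identity as associated isomorphism. -/
theorem stmt_10 (H : Type*) [Group H] (Φ₁ : MulAut H) (w : H)
    (Φ : MulAut (Monoid.Coprod H (Multiplicative ℤ)))
    (hH : ∀ h : H, Φ (Monoid.Coprod.inl h) = Monoid.Coprod.inl (Φ₁ h))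
    (hx : Φ (Monoid.Coprod.inr (Multiplicative.ofAdd 1)) =
      (Monoid.Coprod.inl w)⁻¹ * Monoid.Coprod.inr (Multiplicative.ofAdd 1) *
        Monoid.Coprod.inl w) :
    Nonempty (mappingTorus Φ ≃*
      HNNExtension (mappingTorus Φ₁)
        (Subgroup.zpowers
          (SemidirectProduct.inl w * SemidirectProduct.inr (Multiplicative.ofAdd 1)))
        (Subgroup.zpowers
          (SemidirectProduct.inl w * SemidirectProduct.inr (Multiplicative.ofAdd 1)))
        (MulEquiv.refl _)) := by
  set c : mappingTorus Φ₁ :=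
    SemidirectProduct.inl w * SemidirectProduct.inr (Multiplicative.ofAdd 1) with hc
  let E := HNNExtension (mappingTorus Φ₁) (Subgroup.zpowers c) (Subgroup.zpowers c)
    (MulEquiv.refl _)
  let ι : mappingTorus Φ₁ →* E := HNNExtension.of
  let x : E := HNNExtension.t
  have hcomm : x * ι c = ι c * x :=
    HNNExtension.t_mul_of (φ := MulEquiv.refl (Subgroup.zpowers c))
      ⟨c, Subgroup.mem_zpowers c⟩
  let τ : E := ι (SemidirectProduct.inr (Multiplicative.ofAdd 1))
  let f : Monoid.Coprod H (Multiplicative ℤ) →* E :=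
    Monoid.Coprod.lift (ι.comp SemidirectProduct.inl) (zpowersHom E x)
  have hfl : ∀ h, f (Monoid.Coprod.inl h) = ι (SemidirectProduct.inl h) := by
    intro h; simp [f]
  have hfr : f (Monoid.Coprod.inr (Multiplicative.ofAdd 1)) = x := by simp [f]
  have hιc : ι c = ι (SemidirectProduct.inl w) * τ := map_mul ι _ _
  have hf : ∀ g, f (Φ g) = τ * f g * τ⁻¹ := by
    have : f.comp Φ.toMonoidHom = (MulAut.conj τ).toMonoidHom.comp f := by
      apply Monoid.Coprod.hom_ext
      · ext h
        change f (Φ (Monoid.Coprod.inl h)) = τ * f (Monoid.Coprod.inl h) * τ⁻¹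
        rw [hH, hfl, hfl, mt_conj, map_mul, map_mul, map_inv]
      · apply MonoidHom.ext_mint
        change f (Φ (Monoid.Coprod.inr (Multiplicative.ofAdd 1))) =
          τ * f (Monoid.Coprod.inr (Multiplicative.ofAdd 1)) * τ⁻¹
        rw [hx, map_mul, map_mul, map_inv, hfl, hfr]
        rw [hιc] at hcomm
        rw [eq_mul_inv_iff_mul_eq, mul_assoc, mul_assoc, hcomm]
        group
    intro g
    exact DFunLike.congr_fun this g
  let F : mappingTorus Φ →* E := mtLift Φ f τ hf
  let y : mappingTorus Φ :=
    SemidirectProduct.inl (Monoid.Coprod.inr (Multiplicative.ofAdd 1))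
  let T : mappingTorus Φ := SemidirectProduct.inr (Multiplicative.ofAdd 1)
  let k : mappingTorus Φ₁ →* mappingTorus Φ :=
    mtLift Φ₁ (SemidirectProduct.inl.comp Monoid.Coprod.inl) T (by
      intro h
      change SemidirectProduct.inl (Monoid.Coprod.inl (Φ₁ h)) = _
      rw [← hH, mt_conj]; rfl)
  have hkl : ∀ h, k (SemidirectProduct.inl h) =
      SemidirectProduct.inl (Monoid.Coprod.inl h) := by
    intro h; simp [k]
  have hkr : k (SemidirectProduct.inr (Multiplicative.ofAdd 1)) = T := by simp [k]
  have hyc : Commute y (k c) := by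
    have h1 := mt_conj Φ (Monoid.Coprod.inr (Multiplicative.ofAdd 1))
    rw [hx, map_mul, map_mul, map_inv, eq_mul_inv_iff_mul_eq, mul_assoc, mul_assoc,
      inv_mul_eq_iff_eq_mul] at h1
    change y * k c = k c * y
    rw [hc, map_mul, hkl, hkr, mul_assoc]
    exact h1
  let B : E →* mappingTorus Φ := HNNExtension.lift k y (by
    rintro ⟨a, n, rfl⟩
    change y * k (c ^ n) = k (c ^ n) * y
    rw [map_zpow]
    exact (hyc.zpow_right n).eq)
  have hBι : ∀ g, B (ι g) = k g := fun g => HNNExtension.lift_of _ _ _ g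
  have hBx : B x = y := HNNExtension.lift_t _ _ _
  have hFl : ∀ g, F (SemidirectProduct.inl g) = f g := fun g => mtLift_inl _ _ _ _ g
  have hFT : F T = τ := mtLift_inr _ _ _ _
  have hBf : (B.comp f) = SemidirectProduct.inl := by
    apply Monoid.Coprod.hom_ext
    · ext1 h
      change B (f (Monoid.Coprod.inl h)) = _
      rw [hfl, hBι, hkl]; rfl
    · apply MonoidHom.ext_mint
      change B (f (Monoid.Coprod.inr (Multiplicative.ofAdd 1))) = _
      rw [hfr, hBx]; rfl
  have hBF : B.comp F = MonoidHom.id _ := by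
    apply mt_hom_ext
    · intro g
      change B (F (SemidirectProduct.inl g)) = _
      rw [hFl]
      exact DFunLike.congr_fun hBf g
    · change B (F T) = T
      rw [hFT, hBι, hkr]
  have hFB : F.comp B = MonoidHom.id _ := by
    apply HNNExtension.hom_ext
    · apply mt_hom_ext
      · intro h
        change F (B (ι (SemidirectProduct.inl h))) = ι (SemidirectProduct.inl h)
        rw [hBι, hkl, hFl, hfl]
      · change F (B (ι (SemidirectProduct.inr (Multiplicative.ofAdd 1)))) = τ
        rw [hBι, hkr, hFT]
    · change F (B x) = x
      rw [hBx, hFl, hfr]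
  exact ⟨MonoidHom.toMulEquiv F B hBF hFB⟩
end

section
/- Let T be a finite tree (a finite connected acyclic simple graph) with at least one edge, and let k be the number of vertices of T whose degree is at most 2. Then the number of edges of T is at most 2k − 3. -/
/-- Let `T` be a finite tree with at least one edge, and let `k` be the number
of vertices of `T` of degree at most 2. Then the number of edges of `T` is at most `2k - 3`. -/
theorem stmt_16 {V : Type*} [Fintype V] [DecidableEq V] (G : SimpleGraph V)
    [DecidableRel G.Adj] (hT : G.IsTree) (hE : 1 ≤ G.edgeFinset.card) :
    (G.edgeFinset.card : ℤ) ≤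
      2 * ((Finset.univ.filter fun v => G.degree v ≤ 2).card : ℤ) - 3 := by
  have h1 := hT.card_edgeFinset
  have h2 := G.sum_degrees_eq_twice_card_edges
  have hnt : Nontrivial V := Fintype.one_lt_card_iff_nontrivial.mp (by omega)
  have h3 : ∑ _v : V, 3 ≤ ∑ v : V, (G.degree v + 2 * (if G.degree v ≤ 2 then 1 else 0)) := by
    apply Finset.sum_le_sum
    intro v _
    have := hT.connected.preconnected.degree_pos_of_nontrivial v
    split_ifs <;> omega
  rw [Finset.sum_add_distrib, ← Finset.mul_sum, ← Finset.card_filter, h2] at h3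
  simp only [Finset.sum_const, Finset.card_univ, smul_eq_mul] at h3
  omega
end
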